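/- Let q be an odd prime power, F a finite field with q^6 elements, and h ∈ F with h^(q^3+1) = −1 and h^(q^2) ≠ h. Then 𝓛_h is not PΓL-equivalent to any previously known maximum scattered linear set of PG(1, q^6): it is not PΓL-equivalent to L^1, nor to L^2_δ for any δ ∈ F with δ^((q^6−1)/(q−1)) ∉ {0, 1}, nor to L^3_δ for any δ ∈ F with δ^(q^3+1) ∉ {0, 1}, nor to L^4_δ for any δ ∈ F with δ^2 + δ = 1. -/

import Mathlib

/-- The linear set `L_f` in `ℙ(F × F)` of a map `f : F → F`: the set of projective
points (F-spans) `[(x, f x)]` for `x ∈ F`, `x ≠ 0`. -/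
def linearSet {F : Type} [Field F] (f : F → F) : Set (Projectivization F (F × F)) :=
  {P | ∃ (x : F) (hx : x ≠ 0),
    P = Projectivization.mk F (x, f x) (fun h0 => hx (congrArg Prod.fst h0))}

/-- Two subsets of `ℙ(F × F)` are PΓL-equivalent if there exist a field automorphism
`ρ` of `F` and a bijective `ρ`-semilinear map `g : F × F → F × F` whose induced map on
`ℙ(F × F)` maps `L` onto `L'`. (A bijective additive `ρ`-semilinear map sends nonzero
vectors to nonzero vectors, so the induced map on projective points is total; requiring
the membership equivalence for all nonzero `v` says exactly that the induced bijection
maps `L` onto `L'`.) -/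
def IsPGammaLEquiv {F : Type} [Field F] (L L' : Set (Projectivization F (F × F))) : Prop :=
  ∃ (ρ : F ≃+* F) (g : (F × F) ≃ (F × F)),
    (∀ u v : F × F, g (u + v) = g u + g v) ∧
    (∀ (c : F) (v : F × F), g (c • v) = ρ c • g v) ∧
    (∀ (v : F × F) (hv : v ≠ 0) (hgv : g v ≠ 0),
      (Projectivization.mk F v hv ∈ L ↔ Projectivization.mk F (g v) hgv ∈ L'))

/-- The `q`-polynomial `f_h(x) = h^(q−1)·x^q − h^(q^2−1)·x^(q^2) + x^(q^4) + x^(q^5)`. -/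
def fpol (q : ℕ) {F : Type} [Field F] (h : F) : F → F :=
  fun x => h ^ (q - 1) * x ^ q - h ^ (q ^ 2 - 1) * x ^ (q ^ 2) + x ^ (q ^ 4) + x ^ (q ^ 5)


theorem aux_digit {q a b a' b' : ℕ} (ha : a < q) (ha' : a' < q) (h : a + q * b = a' + q * b') :
    a = a' ∧ b = b' := by
  have hq : 0 < q := by omega
  have h1 := congrArg (· % q) h
  simp only [Nat.add_mul_mod_self_left, Nat.mod_eq_of_lt ha, Nat.mod_eq_of_lt ha'] at h1
  subst h1
  exact ⟨rfl, Nat.eq_of_mul_eq_mul_left hq (by omega)⟩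

theorem digits_base {q : ℕ} (hq : 3 ≤ q) (c e : Fin 6 → ℕ) (he : ∀ i, e i ≤ 1)
    (hc : ∀ i, c i < q)
    (hm : (∑ i, c i * q ^ (i : ℕ)) ≡ (∑ i, e i * q ^ (i : ℕ)) [MOD (q ^ 6 - 1)]) :
    c = e ∨ ∑ i, e i < ∑ i, c i := by
  obtain ⟨N, hN⟩ : ∃ N, q ^ 6 = N + 1 := 
    ⟨q ^ 6 - 1, (Nat.sub_add_cancel (Nat.one_le_pow _ _ (by omega))).symm⟩
  rw [hN, Nat.add_sub_cancel] at hm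
  have hvc : ∑ i, c i * q ^ (i : ℕ) ≤ N := by
    have : ∑ i, c i * q ^ (i : ℕ) ≤ ∑ i : Fin 6, (q - 1) * q ^ (i : ℕ) :=
      Finset.sum_le_sum fun i _ => Nat.mul_le_mul_right _ (by have := hc i; omega)
    have h2 : ∑ i : Fin 6, (q - 1) * q ^ (i : ℕ) = N := by
      obtain ⟨r, rfl⟩ : ∃ r, q = r + 1 := ⟨q - 1, by omega⟩
      simp [Fin.sum_univ_succ]
      have : (N : ℤ) + 1 = (r + 1) ^ 6 := by exact_mod_cast hN.symm
      zify
      linear_combination -this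
    omega
  have hve : ∑ i, e i * q ^ (i : ℕ) < N := by
    have : ∑ i, e i * q ^ (i : ℕ) ≤ ∑ i : Fin 6, q ^ (i : ℕ) :=
      Finset.sum_le_sum fun i _ => by nlinarith [he i, Nat.pow_pos (n := (i : ℕ)) (show 0 < q by omega)]
    have h2 : 2 * ∑ i : Fin 6, q ^ (i : ℕ) ≤ N := by
      obtain ⟨r, rfl⟩ : ∃ r, q = r + 3 := ⟨q - 3, by omega⟩
      have : (N : ℤ) + 1 = (r + 3) ^ 6 := by exact_mod_cast hN.symm
      simp [Fin.sum_univ_succ]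
      zify
      have hr : (0 : ℤ) ≤ r := by positivity
      have h3 : (r : ℤ) * (1 + (r + 3) + (r + 3) ^ 2 + (r + 3) ^ 3 + (r + 3) ^ 4 + (r + 3) ^ 5) ≥ 0 := by
        positivity
      nlinarith [h3]
    have : 0 < ∑ i : Fin 6, q ^ (i : ℕ) := Finset.sum_pos (fun i _ => by positivity) (by simp)
    omega
  rcases lt_or_eq_of_le hvc with h1 | h1
  · have hm' := hm
    unfold Nat.ModEq at hm'
    rw [Nat.mod_eq_of_lt h1, Nat.mod_eq_of_lt hve] at hm'
    left
    have he' : ∀ i, e i < q := fun i => by have := he i; omega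
    have hk : ∀ c : Fin 6 → ℕ, ∑ i, c i * q ^ (i : ℕ) =
        c 0 + q * (c 1 + q * (c 2 + q * (c 3 + q * (c 4 + q * (c 5))))) := by
      intro c
      simp [Fin.sum_univ_six]
      ring
    rw [hk, hk] at hm'
    obtain ⟨h0, hm'⟩ := aux_digit (hc _) (he' _) hm'
    obtain ⟨h1, hm'⟩ := aux_digit (hc _) (he' _) hm'
    obtain ⟨h2, hm'⟩ := aux_digit (hc _) (he' _) hm'
    obtain ⟨h3, hm'⟩ := aux_digit (hc _) (he' _) hm'
    obtain ⟨h4, h5⟩ := aux_digit (hc _) (he' _) hm'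
    funext i
    fin_cases i <;> assumption
  · right
    have hm' := hm
    unfold Nat.ModEq at hm'
    rw [h1, Nat.mod_self, Nat.mod_eq_of_lt hve] at hm'
    have hz : ∀ i, e i = 0 := by
      intro i
      have := (Finset.sum_eq_zero_iff.mp hm'.symm) i (Finset.mem_univ _)
      rcases Nat.mul_eq_zero.mp this with h | h
      · exact h
      · have : 0 < q ^ (i : ℕ) := by positivity
        omega
    simp only [hz, Finset.sum_const_zero]
    rcases Nat.eq_zero_or_pos (∑ i, c i) with h | h
    · have hcz := Finset.sum_eq_zero_iff.mp h
      have : ∑ i, c i * q ^ (i : ℕ) = 0 := Finset.sum_eq_zero fun i hi => by rw [hcz i hi, zero_mul]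
      omega
    · exact h

theorem digits_step {q : ℕ} (hq : 3 ≤ q) (c : Fin 6 → ℕ) (i : Fin 6) (hi : q ≤ c i) :
    ∃ c' : Fin 6 → ℕ, (∑ i, c i * q ^ (i : ℕ)) ≡ (∑ i, c' i * q ^ (i : ℕ)) [MOD (q ^ 6 - 1)] ∧
      ∑ i, c' i < ∑ i, c i := by
  obtain ⟨t, ht⟩ : ∃ t, c i = q + t := ⟨c i - q, by omega⟩
  refine ⟨fun k => if k = i then t else if k = i + 1 then c k + 1 else c k, ?_, ?_⟩
  · rw [← ZMod.natCast_eq_natCast_iff]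
    have h6 : (q : ZMod (q ^ 6 - 1)) ^ 6 = 1 := by
      have h1 : ((q ^ 6 - 1 : ℕ) : ZMod (q ^ 6 - 1)) = 0 := ZMod.natCast_self _
      have : 1 ≤ q ^ 6 := Nat.one_le_pow _ _ (by omega)
      rw [Nat.cast_sub this] at h1
      push_cast at h1
      linear_combination h1
    generalize q ^ 6 - 1 = N at *
    have ht' : (c i : ZMod N) = q + t := by rw [ht]; push_cast; rfl
    fin_cases i <;> simp [Fin.sum_univ_six] at ht' ⊢
    · linear_combination ht'
    · linear_combination (q : ZMod N) * ht'
    · linear_combination (q : ZMod N) ^ 2 * ht'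
    · linear_combination (q : ZMod N) ^ 3 * ht'
    · linear_combination (q : ZMod N) ^ 4 * ht'
    · linear_combination (q : ZMod N) ^ 5 * ht' + h6
  · fin_cases i <;> simp [Fin.sum_univ_six] at ht ⊢ <;> omega

theorem digits_main {q : ℕ} (hq : 3 ≤ q) (e : Fin 6 → ℕ) (he : ∀ i, e i ≤ 1) :
    ∀ (M : ℕ) (c : Fin 6 → ℕ), ∑ i, c i = M →
    (∑ i, c i * q ^ (i : ℕ)) ≡ (∑ i, e i * q ^ (i : ℕ)) [MOD (q ^ 6 - 1)] →
    c = e ∨ ∑ i, e i < ∑ i, c i := by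
  intro M
  induction M using Nat.strong_induction_on with
  | _ M ih =>
    intro c hM hm
    by_cases hc : ∀ i, c i < q
    · exact digits_base hq c e he hc hm
    · push Not at hc
      obtain ⟨i, hi⟩ := hc
      obtain ⟨c', h1, h2⟩ := digits_step hq c i hi
      rcases ih _ (hM ▸ h2) c' rfl (h1.symm.trans hm) with h | h
      · subst h; right; exact h2
      · right; exact h.trans h2

open Classical in
theorem digits_fun {q n : ℕ} (hq : 3 ≤ q) (e p : Fin n → Fin 6) (he : Function.Injective e)
    (hm : (∑ i, q ^ (p i : ℕ)) ≡ (∑ i, q ^ (e i : ℕ)) [MOD (q ^ 6 - 1)]) :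
    ∀ k, ∃ i, p i = e k := by
  have hv : ∀ p : Fin n → Fin 6, ∑ i, q ^ (p i : ℕ) =
      ∑ k, (Finset.univ.filter fun i => p i = k).card * q ^ (k : ℕ) := by
    intro p
    rw [← Finset.sum_fiberwise_of_maps_to (g := p) (t := Finset.univ) (fun _ _ => Finset.mem_univ _)]
    refine Finset.sum_congr rfl fun k _ => ?_
    rw [Finset.sum_congr rfl (g := fun _ => q ^ (k : ℕ))]
    · simp
    · intro i hi
      rw [(Finset.mem_filter.mp hi).2]
  have hs : ∀ p : Fin n → Fin 6, ∑ k, (Finset.univ.filter fun i => p i = k).card = n := by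
    intro p
    rw [← Finset.card_eq_sum_card_fiberwise (f := p) (t := Finset.univ) (fun _ _ => Finset.mem_univ _)]
    simp
  rw [hv, hv] at hm
  have := digits_main hq (fun k => (Finset.univ.filter fun i => e i = k).card) (by
    intro k
    rw [Finset.card_le_one]
    intro a ha b hb
    simp at ha hb
    exact he (ha.trans hb.symm)) _ _ rfl hm
  rw [hs, hs] at this
  simp only [lt_irrefl, or_false] at this
  intro k
  have h1 := congrFun this (e k)
  have h2 : 0 < (Finset.univ.filter fun i => e i = e k).card :=
    Finset.card_pos.mpr ⟨k, by simp⟩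
  rw [← h1] at h2
  obtain ⟨i, hi⟩ := Finset.card_pos.mp h2
  exact ⟨i, by simpa using hi⟩


theorem sum_units_pow {F : Type} [Field F] [Fintype F] [DecidableEq F] (m n : ℕ) :
    ∑ x : Fˣ, ((x : F) ^ m * ((x : F) ^ n)⁻¹) =
      if m ≡ n [MOD (Fintype.card F - 1)] then -1 else 0 := by
  have hc : 1 < Fintype.card F := Fintype.one_lt_card
  obtain ⟨N, hN⟩ : ∃ N, Fintype.card F = N + 2 := ⟨Fintype.card F - 2, by omega⟩
  have h1 : ∀ x : Fˣ, ((x : F) ^ m * ((x : F) ^ n)⁻¹) = ((x ^ (m + n * N) : Fˣ) : F) := by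
    intro x
    rw [← div_eq_mul_inv, div_eq_iff (pow_ne_zero _ x.ne_zero)]
    have h2 := FiniteField.pow_card_sub_one_eq_one (x : F) x.ne_zero
    rw [hN, show N + 2 - 1 = N + 1 by omega] at h2
    push_cast
    rw [← pow_add, show m + n * N + n = m + (N + 1) * n by ring, pow_add, pow_mul, h2, one_pow,
      mul_one]
  rw [Finset.sum_congr rfl fun x _ => h1 x]
  have := FiniteField.sum_pow_units F (m + n * N)
  push_cast
  rw [this, hN, show N + 2 - 1 = N + 1 by omega]
  congr 1
  rw [← Nat.modEq_zero_iff_dvd, eq_iff_iff, ← ZMod.natCast_eq_natCast_iff,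
    ← ZMod.natCast_eq_natCast_iff]
  have h0 : ((N + 1 : ℕ) : ZMod (N + 1)) = 0 := ZMod.natCast_self _
  push_cast at h0 ⊢
  constructor
  · intro h
    linear_combination h - (n : ZMod (N + 1)) * h0
  · intro h
    linear_combination h + (n : ZMod (N + 1)) * h0

/-- The `q`-polynomial with coefficients `a`. -/
def qpol (q : ℕ) {F : Type} [Field F] (a : Fin 6 → F) (x : F) : F :=
  ∑ i : Fin 6, a i * x ^ (q ^ (i : ℕ))

def goodp {n : ℕ} (e p : Fin n → Fin 6) : Prop := ∀ k, ∃ i, p i = e k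

instance {n : ℕ} (e : Fin n → Fin 6) : DecidablePred (goodp e) := fun p =>
  inferInstanceAs (Decidable (∀ k, ∃ i, p i = e k))

theorem goodp_iff {q n : ℕ} (hq : 3 ≤ q) (e p : Fin n → Fin 6) (he : Function.Injective e) :
    (∑ i, q ^ (p i : ℕ)) ≡ (∑ i, q ^ (e i : ℕ)) [MOD (q ^ 6 - 1)] ↔ goodp e p := by
  constructor
  · exact digits_fun hq e p he
  · intro h
    choose j hj using h
    have hinj : Function.Injective j := fun a b hab => he (by rw [← hj, ← hj, hab])
    have hb : Function.Bijective j := Finite.injective_iff_bijective.mp hinj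
    have : ∑ i, q ^ (p i : ℕ) = ∑ i, q ^ (e i : ℕ) := by
      rw [← Equiv.sum_comp (Equiv.ofBijective j hb)]
      simp [hj]
    rw [this]

theorem sum_prod_qpol {q n : ℕ} (hq : 3 ≤ q) {F : Type} [Field F] [Fintype F] [DecidableEq F]
    (hF : Fintype.card F = q ^ 6) (e : Fin n → Fin 6) (he : Function.Injective e)
    (A : Fin n → Fin 6 → F) :
    ∑ x : Fˣ, ∏ i, (qpol q (A i) x * ((x : F) ^ (q ^ (e i : ℕ)))⁻¹) =
      - ∑ p with goodp e p, ∏ i, A i (p i) := by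
  have h1 : ∀ x : Fˣ, ∏ i, (qpol q (A i) x * ((x : F) ^ (q ^ (e i : ℕ)))⁻¹) =
      ∑ p : Fin n → Fin 6, (∏ i, A i (p i)) *
        ((x : F) ^ (∑ i, q ^ (p i : ℕ)) * ((x : F) ^ (∑ i, q ^ (e i : ℕ)))⁻¹) := by
    intro x
    rw [Finset.prod_mul_distrib]
    simp only [qpol]
    rw [Finset.prod_univ_sum, Fintype.piFinset_univ, Finset.sum_mul]
    refine Finset.sum_congr rfl fun p _ => ?_
    rw [Finset.prod_mul_distrib, Finset.prod_pow_eq_pow_sum, Finset.prod_inv_distrib,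
      Finset.prod_pow_eq_pow_sum, mul_assoc]
  rw [Finset.sum_congr rfl fun x _ => h1 x, Finset.sum_comm]
  simp_rw [← Finset.mul_sum, sum_units_pow, hF, goodp_iff hq e _ he]
  rw [Finset.sum_filter, ← Finset.sum_neg_distrib]
  refine Finset.sum_congr rfl fun p _ => ?_
  split_ifs <;> simp

theorem qpol_coeff {q : ℕ} (hq : 3 ≤ q) {F : Type} [Field F] [Fintype F] [DecidableEq F]
    (hF : Fintype.card F = q ^ 6) (a b : Fin 6 → F) (h : ∀ x, qpol q a x = qpol q b x) : a = b := by
  have key : ∀ (c : Fin 6 → F) (k : Fin 6), ∑ x : Fˣ, (qpol q c x * ((x : F) ^ (q ^ (k : ℕ)))⁻¹) = - c k := by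
    intro c k
    have := sum_prod_qpol hq hF ![k] (by intro a b _; exact Subsingleton.elim _ _) ![c]
    simp only [Fin.prod_univ_one, Matrix.cons_val_zero] at this
    rw [this]
    congr 1
    rw [Finset.sum_eq_single ![k]]
    · simp
    · intro p hp hpk
      exfalso
      apply hpk
      obtain ⟨i, hi⟩ := (Finset.mem_filter.mp hp).2 0
      funext j
      rw [Subsingleton.elim j i, hi, Subsingleton.elim i 0]
    · intro hk
      exfalso
      apply hk
      simp only [Finset.mem_filter, Finset.mem_univ, true_and]
      exact fun j => ⟨j, rfl⟩
  funext k
  have h1 := key a k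
  rw [Finset.sum_congr rfl fun x _ => by rw [h x], key b k] at h1
  exact (neg_injective h1).symm

/-- Frobenius power of a `q`-polynomial. -/
theorem qpol_pow {q : ℕ} {F : Type} [Field F] [Fintype F] [DecidableEq F]
    (hF : Fintype.card F = q ^ 6) (φ : F →+* F) (hφ : ∀ x, φ x = x ^ q)
    (a : Fin 6 → F) (x : F) (e : Fin 6) :
    (qpol q a x) ^ (q ^ (e : ℕ)) = qpol q (fun k => (a (k - e)) ^ (q ^ (e : ℕ))) x := by
  have hφn : ∀ (n : ℕ) (x : F), (φ ^ n) x = x ^ (q ^ n) := by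
    intro n
    induction n with
    | zero => intro x; simp
    | succ n ih => intro x; rw [pow_succ, RingHom.mul_def, RingHom.comp_apply, hφ, ih, ← pow_mul, pow_succ, mul_comm]
  have h6 : ∀ x : F, x ^ (q ^ 6) = x := fun x => by rw [← hF]; exact FiniteField.pow_card x
  rw [← hφn]
  unfold qpol
  rw [map_sum, ← Equiv.sum_comp (Equiv.addRight e) (fun k => a (k - e) ^ q ^ (e : ℕ) * x ^ q ^ (k : ℕ))]
  refine Finset.sum_congr rfl fun i _ => ?_
  rw [map_mul, hφn, hφn]
  simp only [Equiv.coe_addRight, add_sub_cancel_right]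
  congr 1
  rw [← pow_mul, ← pow_add]
  rw [Fin.val_add]
  by_cases hlt : (i : ℕ) + e < 6
  · rw [Nat.mod_eq_of_lt hlt]
  · have : (i : ℕ) + e = 6 + ((i : ℕ) + e) % 6 := by omega
    conv_lhs => rw [this, pow_add, pow_mul, h6]


/-- The slopes of the points of a linear set. -/
def slopes {F : Type} [Field F] (f : F → F) : Set F := {m | ∃ x, x ≠ 0 ∧ f x = m * x}

open Classical in
theorem sum_slopes {F : Type} [Field F] [Fintype F] [DecidableEq F] (f : F → F)
    (hf : ∀ x y, f (x + y) = f x + f y) (P : F → F) :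
    ∑ x : Fˣ, P (f x * (x : F)⁻¹) = ∑ m : F, if m ∈ slopes f then - P m else 0 := by
  have hf0 : f 0 = 0 := by simpa using hf 0 0
  rw [← Finset.sum_fiberwise_of_maps_to (s := Finset.univ) (t := Finset.univ)
    (g := fun x : Fˣ => f x * (x : F)⁻¹) (fun _ _ => Finset.mem_univ _)]
  refine Finset.sum_congr rfl fun m _ => ?_
  rw [Finset.sum_congr rfl (g := fun _ => P m)]
  swap
  · intro i hi
    rw [(Finset.mem_filter.mp hi).2]
  rw [Finset.sum_const, nsmul_eq_mul]
  -- the additive subgroup of solutions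
  let G : AddSubgroup F :=
    { carrier := {x | f x = m * x}
      zero_mem' := by simp [hf0]
      add_mem' := by
        intro a b ha hb
        simp only [Set.mem_ofPred_eq] at ha hb ⊢
        rw [hf, ha, hb]; ring
      neg_mem' := by
        intro a ha
        simp only [Set.mem_ofPred_eq] at ha ⊢
        have := hf a (-a)
        rw [add_neg_cancel, hf0, ha] at this
        linear_combination -this }
  have hG : ∀ x, x ∈ G ↔ f x = m * x := fun x => Iff.rfl
  have hcard : Nat.card G =
      (Finset.univ.filter fun x : Fˣ => f x * (x : F)⁻¹ = m).card + 1 := by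
    have e1 : Nat.card G = (Finset.univ.filter fun x : F => x ∈ G).card := by
      rw [Nat.card_eq_fintype_card, Fintype.card_subtype]
    have e2 : (Finset.univ.filter fun x : F => x ∈ G) =
        insert 0 ((Finset.univ.filter fun x : Fˣ => f x * (x : F)⁻¹ = m).map
          ⟨fun x : Fˣ => (x : F), Units.val_injective⟩) := by
      ext x
      simp only [Finset.mem_filter, Finset.mem_univ, true_and, Finset.mem_insert, Finset.mem_map,
        Function.Embedding.coeFn_mk]
      constructor
      · intro hx
        by_cases hx0 : x = 0
        · left; exact hx0
        · right
          refine ⟨Units.mk0 x hx0, ?_, rfl⟩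
          rw [hG] at hx
          simp only [Units.val_mk0]
          rw [hx, mul_assoc, mul_inv_cancel₀ hx0, mul_one]
      · rintro (rfl | ⟨y, hy, rfl⟩)
        · exact G.zero_mem
        · rw [hG, ← hy, mul_assoc, inv_mul_cancel₀ y.ne_zero, mul_one]
    rw [e1, e2, Finset.card_insert_of_notMem, Finset.card_map]
    simp
  split_ifs with hm
  · obtain ⟨p, hp⟩ := CharP.exists F
    have hpp : Nat.Prime p := CharP.char_is_prime F p
    have := Fact.mk hpp
    obtain ⟨x, hx0, hx⟩ := hm
    have hdvd : p ∣ Nat.card G := by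
      have ho : addOrderOf (⟨x, hx⟩ : G) = p := by
        apply addOrderOf_eq_prime
        · apply Subtype.ext
          simp [nsmul_eq_mul]
        · intro h
          exact hx0 (congrArg Subtype.val h)
      rw [← ho]
      exact addOrderOf_dvd_natCard _
    have h0 : ((Nat.card G : ℕ) : F) = 0 := (CharP.cast_eq_zero_iff F p _).mpr hdvd
    rw [hcard] at h0
    push_cast at h0
    linear_combination P m * h0
  · have : (Finset.univ.filter fun x : Fˣ => f x * (x : F)⁻¹ = m) = ∅ := by
      rw [Finset.filter_eq_empty_iff]
      intro x _ hx
      exact hm ⟨x, x.ne_zero, by rw [← hx, mul_assoc, inv_mul_cancel₀ x.ne_zero, mul_one]⟩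
    rw [this]
    simp

theorem qpol_add {q : ℕ} {F : Type} [Field F]
    (φ : F →+* F) (hφ : ∀ x, φ x = x ^ q) (a : Fin 6 → F) (x y : F) :
    qpol q a (x + y) = qpol q a x + qpol q a y := by
  have hφn : ∀ (n : ℕ) (x y : F), (x + y) ^ (q ^ n) = x ^ (q ^ n) + y ^ (q ^ n) := by
    intro n
    induction n with
    | zero => intro x; simp
    | succ n ih =>
      intro x y
      rw [pow_succ, pow_mul, ih, ← hφ, map_add, hφ, hφ, ← pow_mul, ← pow_mul]
  unfold qpol
  rw [← Finset.sum_add_distrib]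
  refine Finset.sum_congr rfl fun i _ => ?_
  rw [hφn]; ring

theorem perm_eq {q n : ℕ} (hq : 3 ≤ q) {F : Type} [Field F] [Fintype F] [DecidableEq F]
    (hF : Fintype.card F = q ^ 6) (φ : F →+* F) (hφ : ∀ x, φ x = x ^ q)
    (e : Fin n → Fin 6) (he : Function.Injective e) (a b : Fin 6 → F)
    (hab : slopes (qpol q a) = slopes (qpol q b)) :
    ∑ p with goodp e p, ∏ i, (a (p i - e i)) ^ (q ^ (e i : ℕ)) =
    ∑ p with goodp e p, ∏ i, (b (p i - e i)) ^ (q ^ (e i : ℕ)) := by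
  have key : ∀ c : Fin 6 → F, ∑ p with goodp e p, ∏ i, (c (p i - e i)) ^ (q ^ (e i : ℕ)) =
      - ∑ x : Fˣ, (∏ i, (qpol q c x * (x : F)⁻¹) ^ (q ^ (e i : ℕ))) := by
    intro c
    have := sum_prod_qpol hq hF e he (fun i k => c (k - e i) ^ (q ^ (e i : ℕ)))
    rw [← neg_eq_iff_eq_neg] at this
    rw [← this]
    congr 1
    refine Finset.sum_congr rfl fun x _ => Finset.prod_congr rfl fun i _ => ?_
    rw [← qpol_pow hF φ hφ, mul_pow, inv_pow]
  rw [key, key, sum_slopes _ (qpol_add φ hφ a) (fun m => ∏ i, m ^ (q ^ (e i : ℕ))),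
    sum_slopes _ (qpol_add φ hφ b) (fun m => ∏ i, m ^ (q ^ (e i : ℕ))), hab]

theorem perm_eq' {q n : ℕ} (hq : 3 ≤ q) {F : Type} [Field F] [Fintype F] [DecidableEq F]
    (hF : Fintype.card F = q ^ 6) (φ : F →+* F) (hφ : ∀ x, φ x = x ^ q)
    (e : Fin n → Fin 6) (he : Function.Injective e) (a b : Fin 6 → F)
    (hab : slopes (qpol q a) = slopes (qpol q b)) (Z : Finset (Fin 6))
    (ha : ∀ k ∈ Z, a k = 0) (hb : ∀ k ∈ Z, b k = 0) :
    ∑ p with goodp e p ∧ ∀ i, p i - e i ∉ Z, ∏ i, (a (p i - e i)) ^ (q ^ (e i : ℕ)) =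
    ∑ p with goodp e p ∧ ∀ i, p i - e i ∉ Z, ∏ i, (b (p i - e i)) ^ (q ^ (e i : ℕ)) := by
  have key : ∀ c : Fin 6 → F, (∀ k ∈ Z, c k = 0) →
      ∑ p with goodp e p ∧ ∀ i, p i - e i ∉ Z, ∏ i, (c (p i - e i)) ^ (q ^ (e i : ℕ)) =
      ∑ p with goodp e p, ∏ i, (c (p i - e i)) ^ (q ^ (e i : ℕ)) := by
    intro c hc
    refine Finset.sum_subset ?_ ?_
    · intro p hp
      simp only [Finset.mem_filter, Finset.mem_univ, true_and] at hp ⊢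
      exact hp.1
    · intro p hp hp'
      simp only [Finset.mem_filter, Finset.mem_univ, true_and] at hp hp'
      push Not at hp'
      obtain ⟨i, hi⟩ := hp' hp
      refine Finset.prod_eq_zero (Finset.mem_univ i) ?_
      rw [hc _ hi]
      have : q ^ (e i : ℕ) ≠ 0 := by positivity
      exact zero_pow this
  rw [key a ha, key b hb, perm_eq hq hF φ hφ e he a b hab]

theorem sets1 : (Finset.univ.filter fun p : Fin 1 → Fin 6 =>
    goodp ![0] p ∧ ∀ i, p i - ![0] i ∉ (∅ : Finset (Fin 6))) = {![0]} := by decide +kernel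
theorem sets03 : (Finset.univ.filter fun p : Fin 2 → Fin 6 =>
    goodp ![0, 3] p ∧ ∀ i, p i - ![0, 3] i ∉ ({0} : Finset (Fin 6))) = {![3, 0]} := by
  decide +kernel
theorem sets01 : (Finset.univ.filter fun p : Fin 2 → Fin 6 =>
    goodp ![0, 1] p ∧ ∀ i, p i - ![0, 1] i ∉ ({0, 3} : Finset (Fin 6))) = {![1, 0]} := by
  decide +kernel
theorem sets02 : (Finset.univ.filter fun p : Fin 2 → Fin 6 =>
    goodp ![0, 2] p ∧ ∀ i, p i - ![0, 2] i ∉ ({0, 3} : Finset (Fin 6))) = {![2, 0]} := by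
  decide +kernel
theorem sets012 : (Finset.univ.filter fun p : Fin 3 → Fin 6 =>
    goodp ![0, 1, 2] p ∧ ∀ i, p i - ![0, 1, 2] i ∉ ({0, 3} : Finset (Fin 6))) =
    {![1, 2, 0], ![2, 0, 1]} := by
  decide +kernel
set_option synthInstance.maxHeartbeats 400000 in
set_option synthInstance.maxSize 4000 in
theorem sets0124_aux : ∀ a : Fin 6, a ≠ 0 ∧ a ≠ 3 → ∀ b : Fin 6, b ≠ 1 ∧ b ≠ 4 → b ≠ a →
    ∀ c : Fin 6, c ≠ 2 ∧ c ≠ 5 → c ≠ a → c ≠ b → ∀ d : Fin 6, d ≠ 4 ∧ d ≠ 1 →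
    (a = 0 ∨ b = 0 ∨ c = 0 ∨ d = 0) → (a = 1 ∨ b = 1 ∨ c = 1 ∨ d = 1) →
    (a = 2 ∨ b = 2 ∨ c = 2 ∨ d = 2) → (a = 4 ∨ b = 4 ∨ c = 4 ∨ d = 4) →
    (a = 1 ∧ b = 0 ∧ c = 4 ∧ d = 2) ∨ (a = 4 ∧ b = 2 ∧ c = 1 ∧ d = 0) ∨
    (a = 1 ∧ b = 2 ∧ c = 4 ∧ d = 0) ∨ (a = 4 ∧ b = 0 ∧ c = 1 ∧ d = 2) := by
  decide +kernel
theorem sets0124 : (Finset.univ.filter fun p : Fin 4 → Fin 6 =>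
    goodp ![0, 1, 2, 4] p ∧ ∀ i, p i - ![0, 1, 2, 4] i ∉ ({0, 3} : Finset (Fin 6))) =
    {![1, 0, 4, 2], ![4, 2, 1, 0], ![1, 2, 4, 0], ![4, 0, 1, 2]} := by
  ext p
  simp only [Finset.mem_filter, Finset.mem_univ, true_and]
  constructor
  · rintro ⟨hg, hz⟩
    have hinj : Function.Injective p := by
      choose j hj using hg
      have he : Function.Injective (![0, 1, 2, 4] : Fin 4 → Fin 6) := by decide
      have hji : Function.Injective j := fun a b hab => he (by rw [← hj, ← hj, hab])
      have hs := Finite.injective_iff_surjective.mp hji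
      intro x y hxy
      obtain ⟨x, rfl⟩ := hs x
      obtain ⟨y, rfl⟩ := hs y
      rw [hj, hj] at hxy
      rw [he hxy]
    have sub : ∀ x y : Fin 6, x - y ∉ ({0, 3} : Finset (Fin 6)) → x ≠ y ∧ x ≠ y + 3 := by decide
    have g0 : ∃ i, p i = 0 := hg 0
    have g1 : ∃ i, p i = 1 := hg 1
    have g2 : ∃ i, p i = 2 := hg 2
    have g3 : ∃ i, p i = 4 := hg 3
    simp only [Fin.exists_fin_succ, Fin.exists_fin_zero, or_false] at g0 g1 g2 g3
    have key := sets0124_aux (p 0) (sub _ 0 (hz 0)) (p 1) (sub _ 1 (hz 1))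
      (hinj.ne (by decide)) (p 2) (sub _ 2 (hz 2)) (hinj.ne (by decide)) (hinj.ne (by decide))
      (p 3) (sub _ 4 (hz 3)) g0 g1 g2 g3
    have ex : ∀ a b c d : Fin 6, (p 0 = a ∧ p 1 = b ∧ p 2 = c ∧ p 3 = d) → p = ![a, b, c, d] := by
      rintro a b c d ⟨rfl, rfl, rfl, rfl⟩
      funext i
      fin_cases i <;> rfl
    simp only [Finset.mem_insert, Finset.mem_singleton]
    rcases key with k | k | k | k
    · exact Or.inl (ex _ _ _ _ k)
    · exact Or.inr (Or.inl (ex _ _ _ _ k))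
    · exact Or.inr (Or.inr (Or.inl (ex _ _ _ _ k)))
    · exact Or.inr (Or.inr (Or.inr (ex _ _ _ _ k)))
  · intro hp
    simp only [Finset.mem_insert, Finset.mem_singleton] at hp
    rcases hp with rfl | rfl | rfl | rfl <;> decide +kernel


theorem hilbert90 {q : ℕ} (hq : 3 ≤ q) {F : Type} [Field F] [Fintype F] [DecidableEq F]
    (hF : Fintype.card F = q ^ 6) (φ : F →+* F) (hφ : ∀ x, φ x = x ^ q) (a : F)
    (ha : a * φ a * φ (φ a) * φ (φ (φ a)) * φ (φ (φ (φ a))) * φ (φ (φ (φ (φ a)))) = 1) :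
    ∃ l : F, l ≠ 0 ∧ a = φ l / l := by
  have ha0 : a ≠ 0 := by rintro rfl; simp at ha
  obtain ⟨g, hg⟩ := IsCyclic.exists_generator (α := Fˣ)
  obtain ⟨k, hk⟩ := (Submonoid.mem_powers_iff _ _).mp (mem_powers_iff_mem_zpowers.mpr (hg (Units.mk0 a ha0)))
  obtain ⟨r, rfl⟩ : ∃ r, q = r + 1 := ⟨q - 1, by omega⟩
  set n := 1 + (r + 1) + (r + 1) ^ 2 + (r + 1) ^ 3 + (r + 1) ^ 4 + (r + 1) ^ 5 with hn
  have hord : orderOf g = r * n := by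
    rw [orderOf_eq_card_of_forall_mem_zpowers hg, Nat.card_eq_fintype_card, Fintype.card_units, hF]
    have : (r + 1) ^ 6 = r * n + 1 := by rw [hn]; ring
    rw [this, Nat.add_sub_cancel]
  have han : a ^ n = 1 := by
    rw [← ha]
    simp only [hφ]
    rw [hn]
    ring
  have h1 : g ^ (k * n) = 1 := by
    rw [pow_mul, hk]
    ext
    simpa using han
  have h2 : r * n ∣ k * n := hord ▸ orderOf_dvd_of_pow_eq_one h1
  have hn0 : 0 < n := by positivity
  obtain ⟨t, ht⟩ := Nat.dvd_of_mul_dvd_mul_right hn0 h2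
  refine ⟨((g ^ t : Fˣ) : F), Units.ne_zero _, ?_⟩
  rw [eq_div_iff (Units.ne_zero _), hφ]
  have : a = ((g ^ k : Fˣ) : F) := by rw [hk]; rfl
  rw [this, ht]
  push_cast
  ring

/-- The polynomial `f_h` written with the Frobenius map. -/
def fA {F : Type} [Field F] (φ : F →+* F) (h x : F) : F :=
  φ h / h * φ x - φ (φ h) / h * φ (φ x) + φ (φ (φ (φ x))) + φ (φ (φ (φ (φ x))))

/-- The adjoint polynomial. -/
def fB {F : Type} [Field F] (φ : F →+* F) (h x : F) : F :=
  φ x + φ (φ x) + h * φ h * φ (φ (φ (φ x))) - h * φ (φ h) * φ (φ (φ (φ (φ x))))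

theorem qpol_phi {q : ℕ} {F : Type} [Field F] (φ : F →+* F) (hφ : ∀ x, φ x = x ^ q)
    (a : Fin 6 → F) (x : F) : qpol q a x = a 0 * x + a 1 * φ x + a 2 * φ (φ x) +
      a 3 * φ (φ (φ x)) + a 4 * φ (φ (φ (φ x))) + a 5 * φ (φ (φ (φ (φ x)))) := by
  simp only [hφ, qpol, Fin.sum_univ_six, ← pow_mul]
  simp
  ring

theorem class_alg {q : ℕ} (hq : 3 ≤ q) {F : Type} [Field F] [Fintype F] [DecidableEq F]
    (hF : Fintype.card F = q ^ 6) (φ : F →+* F) (hφ : ∀ x, φ x = x ^ q)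
    (h6 : ∀ x, φ (φ (φ (φ (φ (φ x))))) = x)
    (h : F) (h0 : h ≠ 0) (hh : φ (φ (φ h)) = - h⁻¹) (a1 a2 a4 a5 : F)
    (e1 : a1 * φ a5 = φ h / h) (e2 : a2 * φ (φ a4) = - (φ (φ h) / h))
    (e3 : a1 * φ a1 * φ (φ a4) + a2 * φ a5 * φ (φ a5) = 0)
    (e4 : a1 * φ a1 * φ (φ a2) * φ (φ (φ (φ a2))) +
      a4 * φ a5 * φ (φ a5) * φ (φ (φ (φ a4))) = 2) :
    ∃ m : F, m ≠ 0 ∧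
      ((∀ x, a1 * φ x + a2 * φ (φ x) + a4 * φ (φ (φ (φ x))) + a5 * φ (φ (φ (φ (φ x)))) =
        m⁻¹ * fA φ h (m * x)) ∨
       (∀ x, a1 * φ x + a2 * φ (φ x) + a4 * φ (φ (φ (φ x))) + a5 * φ (φ (φ (φ (φ x)))) =
        m⁻¹ * fB φ h (m * x))) := by
  have hp0 : φ h ≠ 0 := (map_ne_zero φ).mpr h0
  have hpp0 : φ (φ h) ≠ 0 := (map_ne_zero φ).mpr hp0
  have a10 : a1 ≠ 0 := by
    rintro rfl
    rw [zero_mul] at e1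
    exact div_ne_zero hp0 h0 e1.symm
  have a20 : a2 ≠ 0 := by
    rintro rfl
    rw [zero_mul] at e2
    exact neg_ne_zero.mpr (div_ne_zero hpp0 h0) e2.symm
  have ap10 : φ a1 ≠ 0 := (map_ne_zero φ).mpr a10
  have f5 : φ a5 = φ h / h / a1 := by rw [← e1]; field_simp
  have f4 : φ (φ a4) = - (φ (φ h) / h) / a2 := by rw [← e2]; field_simp
  have f55 : φ (φ a5) = φ (φ h) / φ h / φ a1 := by rw [f5]; simp
  have hsq : (a2 - a1 * φ a1) * (a2 + a1 * φ a1) = 0 := by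
    rw [f4, f55, f5] at e3
    field_simp at e3
    rw [mul_zero] at e3
    have e3' := (mul_eq_zero.mp e3).resolve_left hpp0
    linear_combination e3'
  have a5' : a5 = φ (φ (φ (φ (φ (φ h / h / a1))))) := by rw [← f5, h6]
  have a4' : a4 = φ (φ (φ (φ (- (φ (φ h) / h) / a2)))) := by rw [← f4, h6]
  -- norm is one
  have hprod : (a1 * φ a1 * φ (φ a2) * φ (φ (φ (φ a2)))) *
      (a4 * φ a5 * φ (φ a5) * φ (φ (φ (φ a4)))) = 1 := by
    have e1' := congrArg φ e1
    have e2' := congrArg φ (congrArg φ e2)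
    have e2'' := congrArg φ (congrArg φ e2')
    simp only [map_mul, map_div₀, map_neg, h6, hh, map_inv₀] at e1' e2' e2''
    calc _ = (a1 * φ a5) * (φ a1 * φ (φ a5)) * (φ (φ a2) * φ (φ (φ (φ a4)))) *
          (φ (φ (φ (φ a2))) * a4) := by ring
      _ = 1 := by
        rw [e1, e1', e2', e2'']
        field_simp
  have hone : a1 * φ a1 * φ (φ a2) * φ (φ (φ (φ a2))) = 1 := by
    have : (a1 * φ a1 * φ (φ a2) * φ (φ (φ (φ a2))) - 1) ^ 2 = 0 := by
      linear_combination (a1 * φ a1 * φ (φ a2) * φ (φ (φ (φ a2)))) * e4 - hprod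
    exact sub_eq_zero.mp (pow_eq_zero_iff (two_ne_zero) |>.mp this)
  rcases mul_eq_zero.mp hsq with hc | hc
  · have hc : a2 = a1 * φ a1 := sub_eq_zero.mp hc
    obtain ⟨l, l0, hl⟩ := hilbert90 hq hF φ hφ a1 (by
      rw [hc] at hone
      simp only [map_mul] at hone
      linear_combination hone)
    have pl0 : φ l ≠ 0 := (map_ne_zero φ).mpr l0
    have ppl0 : φ (φ l) ≠ 0 := (map_ne_zero φ).mpr pl0
    have l30 : φ (φ (φ l)) ≠ 0 := (map_ne_zero φ).mpr ppl0
    have l40 : φ (φ (φ (φ l))) ≠ 0 := (map_ne_zero φ).mpr l30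
    have l50 : φ (φ (φ (φ (φ l)))) ≠ 0 := (map_ne_zero φ).mpr l40
    refine ⟨l, l0, Or.inr fun x => ?_⟩
    rw [a5', a4', hc, hl]
    simp only [map_mul, map_div₀, map_neg, h6, hh, map_inv₀, fB]
    field_simp
    ring
  · have hc : a2 = - (a1 * φ a1) := eq_neg_of_add_eq_zero_left hc
    obtain ⟨l, l0, hl⟩ := hilbert90 hq hF φ hφ a1 (by
      rw [hc] at hone
      simp only [map_mul, map_neg] at hone
      linear_combination hone)
    have pl0 : φ l ≠ 0 := (map_ne_zero φ).mpr l0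
    have ppl0 : φ (φ l) ≠ 0 := (map_ne_zero φ).mpr pl0
    have l30 : φ (φ (φ l)) ≠ 0 := (map_ne_zero φ).mpr ppl0
    have l40 : φ (φ (φ (φ l))) ≠ 0 := (map_ne_zero φ).mpr l30
    have l50 : φ (φ (φ (φ (φ l)))) ≠ 0 := (map_ne_zero φ).mpr l40
    refine ⟨l / h, div_ne_zero l0 h0, Or.inl fun x => ?_⟩
    rw [a5', a4', hc, hl]
    simp only [map_mul, map_div₀, map_neg, h6, hh, map_inv₀, fA]
    field_simp
    ring

theorem class_main {q : ℕ} (hq : 3 ≤ q) {F : Type} [Field F] [Fintype F] [DecidableEq F]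
    (hF : Fintype.card F = q ^ 6) (φ : F →+* F) (hφ : ∀ x, φ x = x ^ q)
    (h6 : ∀ x, φ (φ (φ (φ (φ (φ x))))) = x)
    (h : F) (h0 : h ≠ 0) (hh : φ (φ (φ h)) = - h⁻¹) (a : Fin 6 → F)
    (hs : slopes (qpol q a) = slopes (fA φ h)) :
    ∃ m : F, m ≠ 0 ∧
      ((∀ x, qpol q a x = m⁻¹ * fA φ h (m * x)) ∨ (∀ x, qpol q a x = m⁻¹ * fB φ h (m * x))) := by
  have hp0 : φ h ≠ 0 := (map_ne_zero φ).mpr h0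
  have hpp0 : φ (φ h) ≠ 0 := (map_ne_zero φ).mpr hp0
  set b : Fin 6 → F := ![0, φ h / h, - (φ (φ h) / h), 0, 1, 1] with hb
  have hfb : fA φ h = qpol q b := by
    funext x
    rw [qpol_phi φ hφ, fA, hb]
    simp
    ring
  rw [hfb] at hs
  have p0 : ∀ x : F, x ^ (q ^ 0) = x := by simp
  have p1 : ∀ x : F, x ^ (q ^ 1) = φ x := by simp [hφ]
  have p2 : ∀ x : F, x ^ (q ^ 2) = φ (φ x) := by intro x; rw [hφ, hφ, ← pow_mul, pow_two]
  have p3 : ∀ x : F, x ^ (q ^ 3) = φ (φ (φ x)) := by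
    intro x; rw [hφ, ← p2, ← pow_mul, pow_succ q 2]
  have p4 : ∀ x : F, x ^ (q ^ 4) = φ (φ (φ (φ x))) := by
    intro x; rw [hφ, ← p3, ← pow_mul, pow_succ q 3]
  have E1 := perm_eq' hq hF φ hφ ![0] (by decide) a b hs ∅ (by simp) (by simp)
  rw [sets1] at E1
  have a0 : a 0 = 0 := by simpa [hb] using E1
  have E03 := perm_eq' hq hF φ hφ ![0, 3] (by decide) a b hs {0} (by simp [a0]) (by simp [hb])
  rw [sets03] at E03
  simp only [Finset.sum_singleton, Fin.prod_univ_two] at E03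
  have a3 : a 3 = 0 := by
    have d1 : (0 - 3 : Fin 6) = 3 := by decide
    simp [d1, hb, p3] at E03
    exact E03
  have az : ∀ k ∈ ({0, 3} : Finset (Fin 6)), a k = 0 := by simp [a0, a3]
  have bz : ∀ k ∈ ({0, 3} : Finset (Fin 6)), b k = 0 := by simp [hb]
  have b1 : b 1 = φ h / h := rfl
  have b2 : b 2 = - (φ (φ h) / h) := rfl
  have b4 : b 4 = 1 := rfl
  have b5 : b 5 = 1 := rfl
  have E01 := perm_eq' hq hF φ hφ ![0, 1] (by decide) a b hs {0, 3} az bz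
  have E02 := perm_eq' hq hF φ hφ ![0, 2] (by decide) a b hs {0, 3} az bz
  have E012 := perm_eq' hq hF φ hφ ![0, 1, 2] (by decide) a b hs {0, 3} az bz
  have E0124 := perm_eq' hq hF φ hφ ![0, 1, 2, 4] (by decide) a b hs {0, 3} az bz
  rw [sets01] at E01
  rw [sets02] at E02
  rw [sets012] at E012
  rw [sets0124] at E0124
  clear_value b
  have E01' : a 1 * φ (a 5) = b 1 * φ (b 5) := by
    have := E01
    rw [Finset.sum_singleton, Finset.sum_singleton, Fin.prod_univ_two, Fin.prod_univ_two] at this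
    rw [← p1, ← p1, ← p0 (a 1), ← p0 (b 1)]
    exact this
  have E02' : a 2 * φ (φ (a 4)) = b 2 * φ (φ (b 4)) := by
    have := E02
    rw [Finset.sum_singleton, Finset.sum_singleton, Fin.prod_univ_two, Fin.prod_univ_two] at this
    rw [← p2, ← p2, ← p0 (a 2), ← p0 (b 2)]
    exact this
  have s3 : ∀ c : Fin 6 → F, ∑ p ∈ ({![1, 2, 0], ![2, 0, 1]} : Finset (Fin 3 → Fin 6)),
      ∏ i, c (p i - ![0, 1, 2] i) ^ q ^ ((![0, 1, 2] i : Fin 6) : ℕ) =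
      c 1 * φ (c 1) * φ (φ (c 4)) + c 2 * φ (c 5) * φ (φ (c 5)) := by
    intro c
    rw [Finset.sum_pair (by decide), Fin.prod_univ_three, Fin.prod_univ_three]
    change c 1 ^ q ^ 0 * c 1 ^ q ^ 1 * c 4 ^ q ^ 2 + c 2 ^ q ^ 0 * c 5 ^ q ^ 1 * c 5 ^ q ^ 2 = _
    simp only [p0, p1, p2]
  have s4 : ∀ c : Fin 6 → F, ∑ p ∈ ({![1, 0, 4, 2], ![4, 2, 1, 0], ![1, 2, 4, 0], ![4, 0, 1, 2]} :
        Finset (Fin 4 → Fin 6)),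
      ∏ i, c (p i - ![0, 1, 2, 4] i) ^ q ^ ((![0, 1, 2, 4] i : Fin 6) : ℕ) =
      c 1 * φ (c 5) * φ (φ (c 2)) * φ (φ (φ (φ (c 4)))) +
      (c 4 * φ (c 1) * φ (φ (c 5)) * φ (φ (φ (φ (c 2)))) +
      (c 1 * φ (c 1) * φ (φ (c 2)) * φ (φ (φ (φ (c 2)))) +
      c 4 * φ (c 5) * φ (φ (c 5)) * φ (φ (φ (φ (c 4)))))) := by
    intro c
    rw [Finset.sum_insert (by decide), Finset.sum_insert (by decide), Finset.sum_pair (by decide)]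
    simp only [Fin.prod_univ_four]
    change c 1 ^ q ^ 0 * c 5 ^ q ^ 1 * c 2 ^ q ^ 2 * c 4 ^ q ^ 4 +
      (c 4 ^ q ^ 0 * c 1 ^ q ^ 1 * c 5 ^ q ^ 2 * c 2 ^ q ^ 4 +
      (c 1 ^ q ^ 0 * c 1 ^ q ^ 1 * c 2 ^ q ^ 2 * c 2 ^ q ^ 4 +
      c 4 ^ q ^ 0 * c 5 ^ q ^ 1 * c 5 ^ q ^ 2 * c 4 ^ q ^ 4)) = _
    simp only [p0, p1, p2, p4]
  rw [s3, s3, b1, b2, b4, b5] at E012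
  rw [s4, s4, b1, b2, b4, b5] at E0124
  rw [b1, b5, map_one, mul_one] at E01'
  rw [b2, b4, map_one, map_one, mul_one] at E02'
  obtain ⟨m, hm0, hm⟩ := class_alg hq hF φ hφ h6 h h0 hh (a 1) (a 2) (a 4) (a 5) E01' E02'
    (by
      rw [E012]
      simp only [map_mul, map_div₀, map_neg, h6, hh, map_inv₀, map_one]
      field_simp
      ring)
    (by
      have e1' := congrArg φ E01'
      have e2' := congrArg φ (congrArg φ E02')
      have e2'' := congrArg φ (congrArg φ e2')
      simp only [map_mul, map_div₀, map_neg, h6, hh, map_inv₀, map_one] at e1' e2' e2'' E0124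
      have t1 : a 1 * φ (a 5) * φ (φ (a 2)) * φ (φ (φ (φ (a 4)))) =
        (φ h / h) * (-(-(φ h)⁻¹ / φ (φ h))) := by rw [← e2', ← E01']; ring
      have t2 : a 4 * φ (a 1) * φ (φ (a 5)) * φ (φ (φ (φ (a 2)))) =
        (φ (φ h) / φ h) * (-(-(-h⁻¹)⁻¹ / -(φ h)⁻¹)) := by rw [← e2'', ← e1']; ring
      rw [t1, t2] at E0124
      have t3 : ∀ u v w z : F, u + (v + w) = z → w = z - u - v := by
        intro u v w z hz; rw [← hz]; ring
      rw [t3 _ _ _ _ E0124]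
      field_simp
      ring)
  refine ⟨m, hm0, ?_⟩
  have : ∀ x, qpol q a x = a 1 * φ x + a 2 * φ (φ x) + a 4 * φ (φ (φ (φ x))) +
      a 5 * φ (φ (φ (φ (φ x)))) := by
    intro x
    rw [qpol_phi φ hφ, a0, a3]; ring
  simp only [this]
  exact hm


/-- Linear independence of the powers of Frobenius. -/
def Indep {F : Type} [Field F] (φ : F →+* F) : Prop :=
  ∀ c0 c1 c2 c3 c4 c5 : F, (∀ x, c0 * x + c1 * φ x + c2 * φ (φ x) + c3 * φ (φ (φ x)) +
    c4 * φ (φ (φ (φ x))) + c5 * φ (φ (φ (φ (φ x)))) = 0) →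
    c0 = 0 ∧ c1 = 0 ∧ c2 = 0 ∧ c3 = 0 ∧ c4 = 0 ∧ c5 = 0

/-- A `q`-polynomial with vanishing coefficients at `0` and `3`. -/
def fC {F : Type} [Field F] (φ : F →+* F) (a1 a2 a4 a5 x : F) : F :=
  a1 * φ x + a2 * φ (φ x) + a4 * φ (φ (φ (φ x))) + a5 * φ (φ (φ (φ (φ x))))

theorem type1 {F : Type} [Field F] (φ : F →+* F) (hI : Indep φ)
    (h6 : ∀ x, φ (φ (φ (φ (φ (φ x))))) = x) (a1 a2 a4 a5 a b c d : F) (a20 : a2 ≠ 0)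
    (hdet : a * d - b * c ≠ 0)
    (H : ∀ x, φ (a * x + b * fC φ a1 a2 a4 a5 x) = c * x + d * fC φ a1 a2 a4 a5 x) : False := by
  obtain ⟨e0, e1, e2, e3, e4, e5⟩ := hI (φ b * φ a5 - c) (φ a - d * a1) (φ b * φ a1 - d * a2)
    (φ b * φ a2) (- d * a4) (φ b * φ a4 - d * a5) (by
      intro x
      have := H x
      simp only [fC, map_add, map_mul, h6] at this
      linear_combination this)
  have hb : b = 0 := by
    rcases mul_eq_zero.mp e3 with h | h
    · exact (map_eq_zero φ).mp h
    · exact absurd ((map_eq_zero φ).mp h) a20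
  subst hb
  simp only [map_zero, zero_mul, zero_sub, neg_eq_zero] at e2
  have hd := (mul_eq_zero.mp e2).resolve_right a20
  subst hd
  simp at hdet

theorem type2 {F : Type} [Field F] (φ : F →+* F) (hI : Indep φ)
    (h6 : ∀ x, φ (φ (φ (φ (φ (φ x))))) = x) (a1 a2 a4 a5 a b c d δ : F)
    (a20 : a2 ≠ 0) (hdet : a * d - b * c ≠ 0)
    (H : ∀ x, δ * φ (a * x + b * fC φ a1 a2 a4 a5 x) +
      φ (φ (φ (φ (φ (a * x + b * fC φ a1 a2 a4 a5 x))))) = c * x + d * fC φ a1 a2 a4 a5 x) :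
    φ a1 * a4 * φ (φ (φ (φ (φ a4)))) = - (a2 * φ a2 * φ (φ (φ (φ (φ a5))))) := by
  obtain ⟨e0, e1, e2, e3, e4, e5⟩ := hI
    (δ * φ b * φ a5 + φ (φ (φ (φ (φ b)))) * φ (φ (φ (φ (φ a1)))) - c)
    (δ * φ a + φ (φ (φ (φ (φ b)))) * φ (φ (φ (φ (φ a2)))) - d * a1)
    (δ * φ b * φ a1 - d * a2)
    (δ * φ b * φ a2 + φ (φ (φ (φ (φ b)))) * φ (φ (φ (φ (φ a4)))))
    (φ (φ (φ (φ (φ b)))) * φ (φ (φ (φ (φ a5)))) - d * a4)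
    (δ * φ b * φ a4 + φ (φ (φ (φ (φ a)))) - d * a5) (by
      intro x
      have := H x
      simp only [fC, map_add, map_mul, h6] at this
      linear_combination this)
  have hb : b ≠ 0 := by
    rintro rfl
    simp only [map_zero, mul_zero, zero_mul, zero_sub, neg_eq_zero] at e2
    have hd := (mul_eq_zero.mp e2).resolve_right a20
    subst hd
    simp at hdet
  have hb5 : φ (φ (φ (φ (φ b)))) ≠ 0 := by simpa using hb
  apply mul_left_cancel₀ hb5
  linear_combination φ a1 * a4 * e3 - φ a2 * a4 * e2 + a2 * φ a2 * e4

theorem type3 {F : Type} [Field F] (φ : F →+* F) (hI : Indep φ)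
    (h6 : ∀ x, φ (φ (φ (φ (φ (φ x))))) = x) (a1 a2 a4 a5 a b c d δ : F) 
    (a20 : a2 ≠ 0) (hdet : a * d - b * c ≠ 0)
    (H : ∀ x, φ (a * x + b * fC φ a1 a2 a4 a5 x) +
      δ * φ (φ (φ (φ (a * x + b * fC φ a1 a2 a4 a5 x)))) = c * x + d * fC φ a1 a2 a4 a5 x) :
    a5 * (φ a1 * φ (φ (φ (φ a5))) - φ a2 * φ (φ (φ (φ a4)))) =
    a2 * (φ a4 * φ (φ (φ (φ a5))) - φ a2 * φ (φ (φ (φ a1)))) := by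
  obtain ⟨e0, e1, e2, e3, e4, e5⟩ := hI
    (φ b * φ a5 + δ * φ (φ (φ (φ b))) * φ (φ (φ (φ a2))) - c)
    (φ a - d * a1)
    (φ b * φ a1 + δ * φ (φ (φ (φ b))) * φ (φ (φ (φ a4))) - d * a2)
    (φ b * φ a2 + δ * φ (φ (φ (φ b))) * φ (φ (φ (φ a5))))
    (δ * φ (φ (φ (φ a))) - d * a4)
    (φ b * φ a4 + δ * φ (φ (φ (φ b))) * φ (φ (φ (φ a1))) - d * a5) (by
      intro x
      have := H x
      simp only [fC, map_add, map_mul, h6] at this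
      linear_combination this)
  have hb : b ≠ 0 := by
    rintro rfl
    simp only [map_zero, mul_zero, zero_mul, zero_sub, zero_add, neg_eq_zero] at e2
    have hd := (mul_eq_zero.mp e2).resolve_right a20
    subst hd
    simp at hdet
  have hb1 : φ b ≠ 0 := by simpa using hb
  apply mul_left_cancel₀ hb1
  linear_combination (a5 * φ (φ (φ (φ a5)))) * e2 - (a2 * φ (φ (φ (φ a5)))) * e5 -
    (a5 * φ (φ (φ (φ a4))) - a2 * φ (φ (φ (φ a1)))) * e3

theorem type4 {F : Type} [Field F] (φ : F →+* F) (hI : Indep φ)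
    (h6 : ∀ x, φ (φ (φ (φ (φ (φ x))))) = x) (a1 a2 a4 a5 a b c d δ : F) (hδ : φ (φ δ) = δ)
    (hdet : a * d - b * c ≠ 0)
    (H : ∀ x, φ (a * x + b * fC φ a1 a2 a4 a5 x) + φ (φ (φ (a * x + b * fC φ a1 a2 a4 a5 x))) +
      δ * φ (φ (φ (φ (φ (a * x + b * fC φ a1 a2 a4 a5 x))))) = c * x + d * fC φ a1 a2 a4 a5 x) :
    b ≠ 0 ∧ φ b * φ a1 + φ (φ (φ b)) * φ (φ (φ a5)) = d * a2 ∧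
    φ (φ (φ b)) * φ (φ (φ a1)) + δ * φ (φ (φ (φ (φ b)))) * φ (φ (φ (φ (φ a5)))) = d * a4 ∧
    φ b * φ a4 + φ (φ (φ b)) * φ (φ (φ a2)) -
      δ * (φ (φ (φ b)) * φ (φ (φ a2)) + δ * φ b * φ a4) = d * a5 := by
  obtain ⟨e0, e1, e2, e3, e4, e5⟩ := hI
    (φ b * φ a5 + δ * φ (φ (φ (φ (φ b)))) * φ (φ (φ (φ (φ a1)))) - c)
    (φ a + φ (φ (φ b)) * φ (φ (φ a4)) + δ * φ (φ (φ (φ (φ b)))) * φ (φ (φ (φ (φ a2)))) - d * a1)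
    (φ b * φ a1 + φ (φ (φ b)) * φ (φ (φ a5)) - d * a2)
    (φ b * φ a2 + φ (φ (φ a)) + δ * φ (φ (φ (φ (φ b)))) * φ (φ (φ (φ (φ a4)))))
    (φ (φ (φ b)) * φ (φ (φ a1)) + δ * φ (φ (φ (φ (φ b)))) * φ (φ (φ (φ (φ a5)))) - d * a4)
    (φ b * φ a4 + φ (φ (φ b)) * φ (φ (φ a2)) + δ * φ (φ (φ (φ (φ a)))) - d * a5) (by
      intro x
      have := H x
      simp only [fC, map_add, map_mul, h6] at this
      linear_combination this)
  refine ⟨?_, sub_eq_zero.mp e2, sub_eq_zero.mp e4, ?_⟩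
  · rintro rfl
    simp only [map_zero, mul_zero, zero_mul, add_zero, zero_add] at e3
    simp only [map_eq_zero] at e3
    subst e3
    simp at hdet
  · have e3' := congrArg φ (congrArg φ e3)
    simp only [map_add, map_mul, map_zero, h6, hδ] at e3'
    linear_combination e5 - δ * e3'

/-- The hypotheses on `h`. -/
structure Hyp {F : Type} [Field F] (φ : F →+* F) (h : F) : Prop where
  h6 : ∀ x, φ (φ (φ (φ (φ (φ x))))) = x
  two : (2 : F) ≠ 0
  h0 : h ≠ 0
  hh : φ (φ (φ h)) = - h⁻¹
  hne : φ (φ h) ≠ h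
  hI : Indep φ

theorem Hyp.ne_neg {F : Type} [Field F] {φ : F →+* F} {h : F} (X : Hyp φ h) : φ h ≠ - h := by
  intro e
  apply X.hne
  rw [e, map_neg, e, neg_neg]

theorem Hyp.ne_same {F : Type} [Field F] {φ : F →+* F} {h : F} (X : Hyp φ h) : φ h ≠ h := by
  intro e
  apply X.hne
  rw [e, e]

theorem Hyp.sq_ne {F : Type} [Field F] {φ : F →+* F} {h : F} (X : Hyp φ h) :
    φ h ^ 2 ≠ h ^ 2 := by
  intro e
  rcases sq_eq_sq_iff_eq_or_eq_neg.mp e with e | e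
  · exact X.ne_same e
  · exact X.ne_neg e

theorem Hyp.ne_inv {F : Type} [Field F] {φ : F →+* F} {h : F} (X : Hyp φ h) :
    h * φ (φ h) ≠ 1 := by
  intro e
  have e2 := congrArg φ (congrArg φ e)
  simp only [map_mul, map_one] at e2
  have h2 : φ (φ h) ≠ 0 := by simpa using X.h0
  have e3 : φ (φ (φ (φ h))) = h := by
    apply mul_left_cancel₀ h2
    rw [e2, mul_comm, e]
  apply X.hne
  have := congrArg φ (congrArg φ e3)
  rw [X.h6] at this
  exact this.symm

theorem fA_eq {F : Type} [Field F] (φ : F →+* F) (h : F) :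
    fA φ h = fC φ (φ h / h) (- (φ (φ h) / h)) 1 1 := by
  funext x; simp only [fA, fC]; ring

theorem fB_eq {F : Type} [Field F] (φ : F →+* F) (h : F) :
    fB φ h = fC φ 1 1 (h * φ h) (- (h * φ (φ h))) := by
  funext x; simp only [fB, fC]; ring

theorem final2 {F : Type} [Field F] {φ : F →+* F} {h : F} (X : Hyp φ h) (f : F → F)
    (hf : f = fA φ h ∨ f = fB φ h) (a b c d δ : F) (hdet : a * d - b * c ≠ 0)
    (H : ∀ x, δ * φ (a * x + b * f x) + φ (φ (φ (φ (φ (a * x + b * f x))))) = c * x + d * f x) :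
    False := by
  have h0 := X.h0
  have h1 : φ h ≠ 0 := by simpa using X.h0
  have h2 : φ (φ h) ≠ 0 := by simpa using X.h0
  have key : h ^ 2 = 1 → False := by
    intro e
    have e1 := congrArg φ e
    rw [map_pow, map_one] at e1
    exact X.sq_ne (e1.trans e.symm)
  rcases hf with rfl | rfl
  · rw [fA_eq] at H
    have := type2 φ X.hI X.h6 _ _ _ _ a b c d δ (by simp [h0]) hdet H
    simp only [map_mul, map_div₀, map_neg, X.h6, X.hh, map_inv₀, map_one] at this
    field_simp at this
    apply key
    first | linear_combination this | linear_combination -this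
  · rw [fB_eq] at H
    have := type2 φ X.hI X.h6 _ _ _ _ a b c d δ (by simp) hdet H
    simp only [map_mul, map_div₀, map_neg, X.h6, X.hh, map_inv₀, map_one] at this
    field_simp at this
    apply key
    first | linear_combination this | linear_combination -this

theorem final3 {F : Type} [Field F] {φ : F →+* F} {h : F} (X : Hyp φ h) (f : F → F)
    (hf : f = fA φ h ∨ f = fB φ h) (a b c d δ : F) (hdet : a * d - b * c ≠ 0)
    (H : ∀ x, φ (a * x + b * f x) + δ * φ (φ (φ (φ (a * x + b * f x)))) = c * x + d * f x) :
    False := by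
  have h0 := X.h0
  have h1 : φ h ≠ 0 := by simpa using X.h0
  have h2 : φ (φ h) ≠ 0 := by simpa using X.h0
  have key : (h * φ (φ h) - 1) * (φ h + h) = 0 → False := by
    intro e
    rcases mul_eq_zero.mp e with e | e
    · exact X.ne_inv (sub_eq_zero.mp e)
    · exact X.ne_neg (eq_neg_of_add_eq_zero_left e)
  rcases hf with rfl | rfl
  · rw [fA_eq] at H
    have := type3 φ X.hI X.h6 _ _ _ _ a b c d δ (by simp [h0]) hdet H
    simp only [map_mul, map_div₀, map_neg, X.h6, X.hh, map_inv₀, map_one] at this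
    field_simp at this
    apply key
    first | linear_combination this | linear_combination -this
  · rw [fB_eq] at H
    have := type3 φ X.hI X.h6 _ _ _ _ a b c d δ (by simp) hdet H
    simp only [map_mul, map_div₀, map_neg, X.h6, X.hh, map_inv₀, map_one] at this
    field_simp at this
    apply key
    first | linear_combination this | linear_combination -this

theorem final1 {F : Type} [Field F] {φ : F →+* F} {h : F} (X : Hyp φ h) (f : F → F)
    (hf : f = fA φ h ∨ f = fB φ h) (a b c d : F) (hdet : a * d - b * c ≠ 0)
    (H : ∀ x, φ (a * x + b * f x) = c * x + d * f x) : False := by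
  have h0 := X.h0
  rcases hf with rfl | rfl
  · rw [fA_eq] at H
    exact type1 φ X.hI X.h6 _ _ _ _ a b c d (by simp [h0]) hdet H
  · rw [fB_eq] at H
    exact type1 φ X.hI X.h6 _ _ _ _ a b c d (by simp [h0]) hdet H

theorem final4_core {F : Type} [Field F] {φ : F →+* F} {h : F} (X : Hyp φ h) (δ : F)
    (hδ : δ ^ 2 + δ = 1) (hc : φ δ = δ ∨ φ δ = - 1 - δ) (hδ2 : φ (φ δ) = δ)
    (A : δ * φ h + h + h * φ h * (δ * h + φ h) = 0) : False := by
  have h0 := X.h0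
  have h1 : φ h ≠ 0 := by simpa using X.h0
  have h2 : φ (φ h) ≠ 0 := by simpa using X.h0
  have A1 := congrArg φ A
  have A2 := congrArg φ A1
  simp only [map_add, map_mul, map_neg, map_inv₀, map_zero, X.hh, hδ2] at A1 A2
  field_simp at A2
  have B0 : h * (1 + φ h ^ 2) = - δ * φ h * (1 + h ^ 2) := by linear_combination A
  have B1 : φ h * (1 + φ (φ h) ^ 2) = - φ δ * φ (φ h) * (1 + φ h ^ 2) := by linear_combination A1
  have B2 : φ (φ h) * (1 + h ^ 2) = δ * h * (1 + φ (φ h) ^ 2) := by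
    first | linear_combination A2 | linear_combination -A2
  have Y0 : 1 + h ^ 2 ≠ 0 := by
    intro e
    have e1 := congrArg φ e
    rw [map_add, map_pow, map_one, map_zero] at e1
    exact X.sq_ne (by linear_combination e1 - e)
  have key : δ ^ 2 * φ δ = 1 := by
    have : h * φ h * φ (φ h) * (1 + h ^ 2) * (δ ^ 2 * φ δ - 1) = 0 := by
      linear_combination (-h * φ h) * B2 - δ * h ^ 2 * B1 + δ * h * φ δ * φ (φ h) * B0
    have hne : h * φ h * φ (φ h) * (1 + h ^ 2) ≠ 0 := by
      simp only [ne_eq, mul_eq_zero, not_or]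
      exact ⟨⟨⟨h0, h1⟩, h2⟩, Y0⟩
    exact sub_eq_zero.mp ((mul_eq_zero.mp this).resolve_left hne)
  rcases hc with hc | hc
  · rw [hc] at key
    have : (2 : F) * (δ - 1) = 0 := by linear_combination key - (δ - 1) * hδ
    have e := sub_eq_zero.mp ((mul_eq_zero.mp this).resolve_left X.two)
    rw [e] at hδ
    exact one_ne_zero (by linear_combination hδ : (1 : F) = 0)
  · rw [hc] at key
    have e : δ = - 1 := by linear_combination -key - δ * hδ
    rw [e] at hδ
    exact one_ne_zero (by linear_combination -hδ : (1 : F) = 0)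

theorem final4 {F : Type} [Field F] {φ : F →+* F} {h : F} (X : Hyp φ h) (f : F → F)
    (hf : f = fA φ h ∨ f = fB φ h) (a b c d δ : F) (hδ : δ ^ 2 + δ = 1)
    (hdet : a * d - b * c ≠ 0)
    (H : ∀ x, φ (a * x + b * f x) + φ (φ (φ (a * x + b * f x))) +
      δ * φ (φ (φ (φ (φ (a * x + b * f x))))) = c * x + d * f x) :
    False := by
  have h0 := X.h0
  have h1 : φ h ≠ 0 := by simpa using X.h0
  have h2 : φ (φ h) ≠ 0 := by simpa using X.h0
  have hc : φ δ = δ ∨ φ δ = - 1 - δ := by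
    have e := congrArg φ hδ
    rw [map_add, map_pow, map_one] at e
    have : (φ δ - δ) * (φ δ - (-1 - δ)) = 0 := by linear_combination e - hδ
    rcases mul_eq_zero.mp this with h | h
    · left; exact sub_eq_zero.mp h
    · right; exact sub_eq_zero.mp h
  have hδ2 : φ (φ δ) = δ := by
    rcases hc with h | h
    · rw [h, h]
    · rw [h, map_sub, map_neg, map_one, h]; ring
  have hδ0 : δ ≠ 0 := by rintro rfl; simp at hδ
  apply final4_core X δ hδ hc hδ2
  rcases hf with rfl | rfl
  · rw [fA_eq] at H
    obtain ⟨b0, e2, e4, e5⟩ := type4 φ X.hI X.h6 _ _ _ _ a b c d δ hδ2 hdet H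
    have b1 : φ b ≠ 0 := by simpa using b0
    simp only [map_mul, map_div₀, map_neg, X.h6, X.hh, map_inv₀, map_one, mul_one] at e2 e4 e5
    field_simp at e2 e4 e5
    have E4 : δ * φ h * φ (φ h) * φ (φ (φ (φ (φ b)))) =
        - φ b * h * φ (φ h) - φ (φ (φ b)) * h * (φ (φ h) + φ h) := by
      linear_combination φ (φ h) * e4 + e2
    have E5 : φ b * φ (φ h) * (δ * φ h + h) + δ * h * φ h * φ (φ (φ b)) = 0 := by
      linear_combination φ h * e5 + e2 + φ b * φ (φ h) * φ h * hδ
    have E6 := congrArg φ (congrArg φ E5)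
    simp only [map_add, map_mul, map_neg, map_inv₀, map_zero, X.hh, hδ2] at E6
    have E7 : φ (φ (φ b)) * (δ - h * φ (φ h)) = δ * φ h * φ (φ h) * φ (φ (φ (φ (φ b)))) := by
      field_simp at E6
      first | linear_combination E6 | linear_combination -E6
    have E8 : φ (φ (φ b)) * (δ + h * φ h) = - φ b * h * φ (φ h) := by
      linear_combination E7 + E4
    have E9 : (φ b * φ (φ h) * δ) * (δ * φ h + h + h * φ h * (δ * h + φ h)) = 0 := by
      linear_combination (δ + h * φ h) * E5 - δ * h * φ h * E8 + φ b * φ (φ h) * h ^ 2 * φ h * hδ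
    exact (mul_eq_zero.mp E9).resolve_left (mul_ne_zero (mul_ne_zero b1 h2) hδ0)
  · rw [fB_eq] at H
    obtain ⟨b0, e2, e4, e5⟩ := type4 φ X.hI X.h6 _ _ _ _ a b c d δ hδ2 hdet H
    have b1 : φ b ≠ 0 := by simpa using b0
    simp only [map_mul, map_neg, X.hh, map_inv₀, map_one, mul_one] at e2 e4 e5
    field_simp at e2 e4 e5
    have E4 : δ * φ (φ (φ (φ (φ b)))) * φ h =
        φ b * h * φ h * φ (φ h) - φ (φ (φ b)) * (φ (φ h) + φ h) := by
      linear_combination e4 - φ h * e2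
    have E5 : φ b * φ (φ h) * (δ * φ h + h) = δ * φ (φ (φ b)) := by
      linear_combination e5 + e2 + φ b * φ (φ h) * φ h * hδ
    have E6 := congrArg φ (congrArg φ E5)
    simp only [map_add, map_mul, map_neg, map_inv₀, map_zero, X.hh, hδ2] at E6
    have E7 : φ (φ (φ b)) * (δ - h * φ (φ h)) = δ * h * φ h * φ (φ (φ (φ (φ b)))) := by
      field_simp at E6
      first | linear_combination E6 | linear_combination -E6
    have E8 : φ (φ (φ b)) * (δ + h * φ h) = φ b * h ^ 2 * φ h * φ (φ h) := by
      linear_combination E7 + h * E4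
    have E9 : (φ b * φ (φ h) * δ) * (δ * φ h + h + h * φ h * (δ * h + φ h)) = 0 := by
      linear_combination (δ + h * φ h) * E5 + δ * E8 + φ b * φ (φ h) * h ^ 2 * φ h * hδ
    exact (mul_eq_zero.mp E9).resolve_left (mul_ne_zero (mul_ne_zero b1 h2) hδ0)


theorem qpol_comp {q : ℕ} {F : Type} [Field F] [Fintype F] [DecidableEq F]
    (hF : Fintype.card F = q ^ 6) (φ : F →+* F) (hφ : ∀ x, φ x = x ^ q)
    (a b : Fin 6 → F) : ∃ c : Fin 6 → F, ∀ x, qpol q a (qpol q b x) = qpol q c x := by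
  refine ⟨fun k => ∑ i : Fin 6, a i * (b (k - i)) ^ (q ^ (i : ℕ)), fun x => ?_⟩
  have e : qpol q a (qpol q b x) = ∑ i : Fin 6, a i * (qpol q b x) ^ (q ^ (i : ℕ)) := rfl
  rw [e]
  simp only [qpol_pow hF φ hφ]
  simp only [qpol, Finset.mul_sum, Finset.sum_mul]
  rw [Finset.sum_comm]
  simp only [mul_assoc]

theorem qpol_inv {q : ℕ} {F : Type} [Field F] [Fintype F] [DecidableEq F]
    (hF : Fintype.card F = q ^ 6) (φ : F →+* F) (hφ : ∀ x, φ x = x ^ q)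
    (a : Fin 6 → F) (ha : Function.Injective (qpol q a)) :
    ∃ b : Fin 6 → F, ∀ x, qpol q a (qpol q b x) = x := by
  let e : Equiv.Perm F := Equiv.ofBijective (qpol q a) (Finite.injective_iff_bijective.mp ha)
  have he : ∀ x, e x = qpol q a x := fun x => rfl
  have hp : ∀ n : ℕ, ∃ b : Fin 6 → F, ∀ x, (e ^ n) x = qpol q b x := by
    intro n
    induction n with
    | zero =>
      refine ⟨![1, 0, 0, 0, 0, 0], fun x => ?_⟩
      rw [qpol_phi φ hφ]
      simp
    | succ n ih =>
      obtain ⟨b, hb⟩ := ih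
      obtain ⟨c, hc⟩ := qpol_comp hF φ hφ a b
      refine ⟨c, fun x => ?_⟩
      rw [pow_succ', Equiv.Perm.mul_apply, hb, he, hc]
  obtain ⟨b, hb⟩ := hp (orderOf e - 1)
  refine ⟨b, fun x => ?_⟩
  rw [← hb, ← he, ← Equiv.Perm.mul_apply, ← pow_succ', Nat.sub_add_cancel (orderOf_pos e),
    pow_orderOf_eq_one]
  rfl

theorem mem_linearSet {F : Type} [Field F] (g : F → F) (u v : F) (huv : ((u, v) : F × F) ≠ 0) :
    Projectivization.mk F ((u, v) : F × F) huv ∈ linearSet g ↔ ∃ x, x ≠ 0 ∧ v * x = u * g x := by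
  constructor
  · rintro ⟨x, hx, e⟩
    obtain ⟨a, ha⟩ := (Projectivization.mk_eq_mk_iff' F _ _ _ _).mp e
    simp only [Prod.smul_mk, Prod.mk.injEq, smul_eq_mul] at ha
    refine ⟨x, hx, ?_⟩
    rw [← ha.1, ← ha.2]; ring
  · rintro ⟨x, hx, e⟩
    refine ⟨x, hx, ?_⟩
    rw [Projectivization.mk_eq_mk_iff']
    refine ⟨u / x, ?_⟩
    simp only [Prod.smul_mk, Prod.mk.injEq, smul_eq_mul]
    constructor
    · field_simp
    · field_simp; linear_combination -e

theorem Hyp.map {F : Type} [Field F] {φ : F →+* F} {h : F} (X : Hyp φ h) (ρ : F ≃+* F)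
    (hρ : ∀ x, φ (ρ x) = ρ (φ x)) : Hyp φ (ρ h) where
  h6 := X.h6
  two := X.two
  h0 := by simpa using X.h0
  hh := by simp only [hρ, X.hh, map_neg, map_inv₀]
  hne := by simpa only [hρ, ne_eq, EmbeddingLike.apply_eq_iff_eq] using X.hne
  hI := X.hI

theorem fA_map {F : Type} [Field F] (φ : F →+* F) (h x : F) (ρ : F ≃+* F)
    (hρ : ∀ x, φ (ρ x) = ρ (φ x)) : ρ (fA φ h x) = fA φ (ρ h) (ρ x) := by
  simp only [fA, hρ, map_add, map_sub, map_mul, map_div₀]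

theorem transfer {q : ℕ} (hq : 3 ≤ q) {F : Type} [Field F] [Fintype F] [DecidableEq F]
    (hF : Fintype.card F = q ^ 6) (φ : F →+* F) (hφ : ∀ x, φ x = x ^ q)
    (h : F) (X : Hyp φ h) (w : Fin 6 → F)
    (E : IsPGammaLEquiv (linearSet (fA φ h)) (linearSet (qpol q w))) :
    ∃ h', Hyp φ h' ∧ ∃ f, (f = fA φ h' ∨ f = fB φ h') ∧ ∃ a b c d : F, a * d - b * c ≠ 0 ∧
      ∀ x, qpol q w (a * x + b * f x) = c * x + d * f x := by
  obtain ⟨ρ, G, Gadd, Gsmul, Gm⟩ := E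
  have hρ : ∀ x, φ (ρ x) = ρ (φ x) := fun x => by rw [hφ, hφ, map_pow]
  have X' := X.map ρ hρ
  obtain ⟨A, hA⟩ : ∃ A, A = (G (1, 0)).1 := ⟨_, rfl⟩
  obtain ⟨B, hB⟩ : ∃ B, B = (G (1, 0)).2 := ⟨_, rfl⟩
  obtain ⟨C, hC⟩ : ∃ C, C = (G (0, 1)).1 := ⟨_, rfl⟩
  obtain ⟨D, hD⟩ : ∃ D, D = (G (0, 1)).2 := ⟨_, rfl⟩
  have hG : ∀ x y, G (x, y) = (ρ x * A + ρ y * C, ρ x * B + ρ y * D) := by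
    intro x y
    have e : ((x, y) : F × F) = x • (1, 0) + y • (0, 1) := by simp
    rw [e, Gadd, Gsmul, Gsmul]
    ext <;> simp [hA, hB, hC, hD]
  have G0 : G 0 = 0 := by
    have := hG 0 0
    simp only [map_zero, zero_mul, add_zero] at this
    exact this
  have Gne : ∀ v, v ≠ 0 → G v ≠ 0 := fun v hv e => hv (G.injective (e.trans G0.symm))
  have mem : ∀ x y, ((x, y) : F × F) ≠ 0 → ((∃ t, t ≠ 0 ∧ y * t = x * fA φ h t) ↔
      ∃ t, t ≠ 0 ∧ (ρ x * B + ρ y * D) * t = (ρ x * A + ρ y * C) * qpol q w t) := by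
    intro x y hxy
    have h1 := Gm (x, y) hxy (Gne _ hxy)
    rw [mem_linearSet] at h1
    rw [h1]
    have h2 := Gne _ hxy
    simp only [hG] at h2 ⊢
    rw [mem_linearSet]
  have hdet : A * D - C * B ≠ 0 := by
    intro e
    have k1 : ∀ x y, ρ x * A + ρ y * C = 0 → ρ x * B + ρ y * D = 0 → x = 0 ∧ y = 0 := by
      intro x y e1 e2
      by_contra hc
      have hv : ((x, y) : F × F) ≠ 0 := by
        intro e; apply hc; simpa using e
      apply Gne _ hv
      rw [hG, e1, e2]; rfl
    obtain ⟨c0, a0⟩ := k1 (ρ.symm C) (- ρ.symm A) (by simp; ring) (by simp; linear_combination -e)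
    have c0' : C = 0 := by simpa using c0
    have a0' : A = 0 := by simpa using a0
    obtain ⟨d0, b0⟩ := k1 (ρ.symm D) (- ρ.symm B) (by simp [c0', a0']) (by simp; ring)
    have b0' : B = 0 := by simpa using b0
    have := (k1 1 0 (by simp [a0']) (by simp [b0'])).1
    exact one_ne_zero this
  -- the maps Phi and Psi
  obtain ⟨P, hP⟩ : ∃ P : Fin 6 → F, ∀ t, qpol q P t = D * t - C * qpol q w t := by
    refine ⟨![D - C * w 0, - C * w 1, - C * w 2, - C * w 3, - C * w 4, - C * w 5], fun t => ?_⟩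
    rw [qpol_phi φ hφ, qpol_phi φ hφ]
    simp
    ring
  obtain ⟨S, hS⟩ : ∃ S : Fin 6 → F, ∀ t, qpol q S t = - B * t + A * qpol q w t := by
    refine ⟨![- B + A * w 0, A * w 1, A * w 2, A * w 3, A * w 4, A * w 5], fun t => ?_⟩
    rw [qpol_phi φ hφ, qpol_phi φ hφ]
    simp
    ring
  have Pne : ∀ t, qpol q P t = 0 → t = 0 := by
    intro t ht
    by_contra ht0
    have h1 := (mem 0 1 (by simp)).mpr ⟨t, ht0, by
      rw [hP] at ht
      simp only [map_zero, map_one]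
      linear_combination ht⟩
    obtain ⟨t', ht', e⟩ := h1
    apply ht'
    simpa using e
  have Padd := qpol_add φ hφ P
  have Pinj : Function.Injective (qpol q P) := by
    intro x y e
    have h1 := Padd (x - y) y
    rw [sub_add_cancel, e] at h1
    have := Pne (x - y) (by linear_combination -h1)
    exact sub_eq_zero.mp this
  obtain ⟨R, hR⟩ := qpol_inv hF φ hφ P Pinj
  have P0 : qpol q P 0 = 0 := by have := Padd 0 0; simpa using this
  obtain ⟨T, hT⟩ := qpol_comp hF φ hφ S R
  have hs : slopes (qpol q T) = slopes (fA φ (ρ h)) := by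
    ext n
    have h1 := mem 1 (ρ.symm n) (by simp)
    simp only [map_one, RingEquiv.apply_symm_apply] at h1
    have h2 : n ∈ slopes (fA φ (ρ h)) ↔ (∃ t, t ≠ 0 ∧ ρ.symm n * t = 1 * fA φ h t) := by
      constructor
      · rintro ⟨x, hx, e⟩
        refine ⟨ρ.symm x, by simpa using hx, ?_⟩
        apply ρ.injective
        rw [map_mul, map_mul, fA_map φ h _ ρ hρ]
        simp [e]
      · rintro ⟨x, hx, e⟩
        refine ⟨ρ x, by simpa using hx, ?_⟩
        rw [← fA_map φ h _ ρ hρ, ← one_mul (fA φ h x), ← e]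
        simp
    rw [h2, h1]
    constructor
    · rintro ⟨x, hx, e⟩
      refine ⟨qpol q R x, ?_, ?_⟩
      · intro e0
        have := hR x
        rw [e0, P0] at this
        exact hx this.symm
      · rw [← hT, hS] at e
        have e2 := hR x
        rw [hP] at e2
        linear_combination -e + n * e2
    · rintro ⟨t, ht, e⟩
      refine ⟨qpol q P t, fun e0 => ht (Pne t e0), ?_⟩
      have e3 : qpol q R (qpol q P t) = t := Pinj (hR _)
      rw [← hT, e3, hS, hP]
      linear_combination -e
  obtain ⟨m, hm, hfm⟩ := class_main hq hF φ hφ X.h6 (ρ h) X'.h0 X'.hh T hs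
  have main : ∀ f : F → F, (∀ x, qpol q T x = m⁻¹ * f (m * x)) →
      ∃ a b c d : F, a * d - b * c ≠ 0 ∧
      ∀ x, qpol q w (a * x + b * f x) = c * x + d * f x := by
    intro f hf
    obtain ⟨Δ, hΔ⟩ : ∃ Δ, Δ = A * D - C * B := ⟨_, rfl⟩
    rw [← hΔ] at hdet
    refine ⟨A / (Δ * m), C / (Δ * m), B / (Δ * m), D / (Δ * m), ?_, ?_⟩
    · have e : A / (Δ * m) * (D / (Δ * m)) - C / (Δ * m) * (B / (Δ * m)) = (A * D - C * B) / (Δ * m) ^ 2 := by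
        ring
      rw [e, ← hΔ]
      exact div_ne_zero hdet (pow_ne_zero _ (mul_ne_zero hdet hm))
    · intro x
      have e1 := hR (m⁻¹ * x)
      have e2 := hT (m⁻¹ * x)
      rw [hf, mul_inv_cancel_left₀ hm, hS] at e2
      rw [hP] at e1
      set z := qpol q R (m⁻¹ * x)
      have e3 : A / (Δ * m) * x + C / (Δ * m) * f x = z := by
        have : A * (m⁻¹ * x) + C * (m⁻¹ * f x) = Δ * z := by
          rw [← e1, ← e2, hΔ]; ring
        field_simp at this ⊢
        linear_combination this
      rw [e3]
      have : B * (m⁻¹ * x) + D * (m⁻¹ * f x) = Δ * qpol q w z := by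
        rw [← e1, ← e2, hΔ]; ring
      field_simp at this ⊢
      linear_combination -this
  rcases hfm with hfm | hfm
  · exact ⟨ρ h, X', _, Or.inl rfl, main _ hfm⟩
  · exact ⟨ρ h, X', _, Or.inr rfl, main _ hfm⟩

theorem indep_of {q : ℕ} (hq : 3 ≤ q) {F : Type} [Field F] [Fintype F] [DecidableEq F]
    (hF : Fintype.card F = q ^ 6) (φ : F →+* F) (hφ : ∀ x, φ x = x ^ q) : Indep φ := by
  intro c0 c1 c2 c3 c4 c5 H
  have e := qpol_coeff hq hF ![c0, c1, c2, c3, c4, c5] ![0, 0, 0, 0, 0, 0] (by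
    intro x
    rw [qpol_phi φ hφ, qpol_phi φ hφ]
    simpa using H x)
  simpa using e

theorem setup {q : ℕ} (hq : IsPrimePow q) (hodd : Odd q)
    {F : Type} [Field F] [Fintype F] [DecidableEq F] (hF : Fintype.card F = q ^ 6)
    (h : F) (hh : h ^ (q ^ 3 + 1) = -1) (hq2 : h ^ (q ^ 2) ≠ h) :
    3 ≤ q ∧ ∃ φ : F →+* F, (∀ x, φ x = x ^ q) ∧ Hyp φ h ∧ fpol q h = fA φ h := by
  obtain ⟨p, s, hp, hs, rfl⟩ := (isPrimePow_nat_iff q).mp hq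
  have h1 : 1 < p ^ s := Nat.one_lt_pow hs.ne' hp.one_lt
  have h3 : 3 ≤ p ^ s := by obtain ⟨k, hk⟩ := hodd; omega
  refine ⟨h3, ?_⟩
  haveI : Fact p.Prime := ⟨hp⟩
  haveI : CharP F p := by
    obtain ⟨r, hr⟩ := CharP.exists F
    haveI := hr
    obtain ⟨n, hr', hn⟩ := FiniteField.card F r
    have : p ∣ r := by
      have : p ∣ r ^ (n : ℕ) := by
        rw [← hn, hF, ← pow_mul]
        exact dvd_pow_self _ (by omega)
      exact hp.dvd_of_dvd_pow this
    rw [(Nat.prime_dvd_prime_iff_eq hp hr').mp this]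
    exact hr
  have hφ : ∀ x : F, iterateFrobenius F p s x = x ^ (p ^ s) := fun x => iterateFrobenius_def _ _ _
  generalize iterateFrobenius F p s = φ at hφ
  refine ⟨φ, hφ, ?_⟩
  have two : (2 : F) ≠ 0 := by
    intro e
    have : p ∣ 2 := (CharP.cast_eq_zero_iff F p 2).mp (by exact_mod_cast e)
    rw [(Nat.prime_dvd_prime_iff_eq hp Nat.prime_two).mp this] at hodd
    exact (Nat.not_even_iff_odd.mpr hodd) ((Nat.even_pow).mpr ⟨even_two, hs.ne'⟩)
  generalize hqq : p ^ s = q at *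
  have h0 : h ≠ 0 := by
    rintro rfl
    simp at hh
  have h6 : ∀ x : F, φ (φ (φ (φ (φ (φ x))))) = x := by
    intro x
    simp only [hφ, ← pow_mul]
    have := FiniteField.pow_card x
    rw [hF] at this
    rw [← this]
    congr 1
    · ring
  have hX : Hyp φ h := by
    refine ⟨h6, two, h0, ?_, ?_, indep_of h3 hF φ hφ⟩
    · rw [pow_succ] at hh
      have : φ (φ (φ h)) = h ^ (q ^ 3) := by
        simp only [hφ, ← pow_mul]; congr 1; ring
      rw [this, eq_comm, neg_eq_iff_eq_neg, inv_eq_iff_eq_inv, eq_comm]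
      apply inv_eq_of_mul_eq_one_left
      linear_combination -hh
    · have : φ (φ h) = h ^ (q ^ 2) := by
        simp only [hφ, ← pow_mul]; congr 1; ring
      rwa [this]
  refine ⟨hX, ?_⟩
  funext x
  have e1 : h ^ (q - 1) = φ h / h := by
    rw [eq_div_iff h0, hφ, ← pow_succ]; congr 1; omega
  have e2 : h ^ (q ^ 2 - 1) = φ (φ h) / h := by
    have : 1 ≤ q ^ 2 := Nat.one_le_pow _ _ (by omega)
    rw [eq_div_iff h0, hφ, hφ, ← pow_succ, ← pow_mul]; congr 1
    rw [← sq]; omega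
  rw [fpol, fA, e1, e2]
  simp only [hφ x, hφ (x ^ _), ← pow_mul]
  ring

/-- Let `q` be an odd prime power, `F` a finite field with `q^6` elements,
and `h ∈ F` with `h^(q^3+1) = −1` and `h^(q^2) ≠ h`. Then `𝓛_h` is not PΓL-equivalent to
any previously known maximum scattered linear set of `PG(1,q^6)`: not to `L^1`, nor to
`L^2_δ` for any `δ` with `δ^((q^6−1)/(q−1)) ∉ {0,1}`, nor to `L^3_δ` for any `δ` with
`δ^(q^3+1) ∉ {0,1}`, nor to `L^4_δ` for any `δ` with `δ^2 + δ = 1`. -/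
theorem stmt13 (q : ℕ) (hq : IsPrimePow q) (hodd : Odd q)
    (F : Type) [Field F] [Fintype F] (hF : Fintype.card F = q ^ 6)
    (h : F) (hh : h ^ (q ^ 3 + 1) = -1) (hq2 : h ^ (q ^ 2) ≠ h) :
    (¬ IsPGammaLEquiv (linearSet (fpol q h)) (linearSet (fun x : F => x ^ q))) ∧
    (∀ δ : F, δ ^ ((q ^ 6 - 1) / (q - 1)) ≠ 0 → δ ^ ((q ^ 6 - 1) / (q - 1)) ≠ 1 →
      ¬ IsPGammaLEquiv (linearSet (fpol q h))
          (linearSet (fun x : F => δ * x ^ q + x ^ (q ^ 5)))) ∧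
    (∀ δ : F, δ ^ (q ^ 3 + 1) ≠ 0 → δ ^ (q ^ 3 + 1) ≠ 1 →
      ¬ IsPGammaLEquiv (linearSet (fpol q h))
          (linearSet (fun x : F => x ^ q + δ * x ^ (q ^ 4)))) ∧
    (∀ δ : F, δ ^ 2 + δ = 1 →
      ¬ IsPGammaLEquiv (linearSet (fpol q h))
          (linearSet (fun x : F => x ^ q + x ^ (q ^ 3) + δ * x ^ (q ^ 5)))) := by
  classical
  obtain ⟨h3, φ, hφ, X, hf⟩ := setup hq hodd hF h hh hq2
  rw [hf]
  have two : ∀ x : F, x ^ (q ^ 3) = φ (φ (φ x)) := by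
    intro x; simp only [hφ, ← pow_mul]; congr 1; ring
  have four : ∀ x : F, x ^ (q ^ 4) = φ (φ (φ (φ x))) := by
    intro x; simp only [hφ, ← pow_mul]; congr 1; ring
  have five : ∀ x : F, x ^ (q ^ 5) = φ (φ (φ (φ (φ x)))) := by
    intro x; simp only [hφ, ← pow_mul]; congr 1; ring
  refine ⟨?_, ?_, ?_, ?_⟩
  · intro E
    have e : (fun x : F => x ^ q) = qpol q ![0, 1, 0, 0, 0, 0] := by
      funext x
      rw [qpol_phi φ hφ, ← hφ]
      simp
    rw [e] at E
    obtain ⟨h', X', f, hf', a, b, c, d, hdet, H⟩ := transfer h3 hF φ hφ h X _ E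
    refine final1 X' f hf' a b c d hdet fun x => ?_
    rw [← H x, ← e, hφ]
  · intro δ _ _ E
    have e : (fun x : F => δ * x ^ q + x ^ (q ^ 5)) = qpol q ![0, δ, 0, 0, 0, 1] := by
      funext x
      rw [qpol_phi φ hφ, five, ← hφ]
      simp
    rw [e] at E
    obtain ⟨h', X', f, hf', a, b, c, d, hdet, H⟩ := transfer h3 hF φ hφ h X _ E
    refine final2 X' f hf' a b c d δ hdet fun x => ?_
    rw [← H x, ← five, ← e, hφ]
  · intro δ _ _ E
    have e : (fun x : F => x ^ q + δ * x ^ (q ^ 4)) = qpol q ![0, 1, 0, 0, δ, 0] := by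
      funext x
      rw [qpol_phi φ hφ, four, ← hφ]
      simp
    rw [e] at E
    obtain ⟨h', X', f, hf', a, b, c, d, hdet, H⟩ := transfer h3 hF φ hφ h X _ E
    refine final3 X' f hf' a b c d δ hdet fun x => ?_
    rw [← H x, ← four, ← e, hφ]
  · intro δ hδ E
    have e : (fun x : F => x ^ q + x ^ (q ^ 3) + δ * x ^ (q ^ 5)) =
        qpol q ![0, 1, 0, 1, 0, δ] := by
      funext x
      rw [qpol_phi φ hφ, two, five, ← hφ]
      simp
    rw [e] at E
    obtain ⟨h', X', f, hf', a, b, c, d, hdet, H⟩ := transfer h3 hF φ hφ h X _ E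
    refine final4 X' f hf' a b c d δ hδ hdet fun x => ?_
    rw [← H x, ← five, ← two, ← e, hφ]
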